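/- arXiv:1402.0601 — 11 statements merged into one kernel-verified Lean document; each statement's English description precedes it below -/
import Mathlib

section
/- Let M be a synchronous machine. If there exists a synchronous unwinding relation on M (i.e., M satisfies RES), then M satisfies Nondeducibility on Strategies (NDS). -/
/-- A synchronous machine (without the input-enabledness proof, which is
stated separately as `SyncMachine.InputEnabled`). -/
structure SyncMachine (S AH AL O : Type) where
  init : S
  trans : S → AH × AL → S → Prop
  obsH : S → O
  obsL : S → O

namespace SyncMachine

variable {S AH AL O : Type}

/-- The machine is input-enabled. -/
def InputEnabled (M : SyncMachine S AH AL O) : Prop :=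
  ∀ s a, ∃ t, M.trans s a t

/-- A step of a run: a joint action together with the resulting state. -/
abbrev Step (S AH AL : Type) := (AH × AL) × S

def IsRunFrom (M : SyncMachine S AH AL O) : S → List (Step S AH AL) → Prop
  | _, [] => True
  | s, (a, t) :: rest => M.trans s a t ∧ M.IsRunFrom t rest

/-- A run of the machine, starting at the initial state; represented as its
list of steps. -/
def IsRun (M : SyncMachine S AH AL O) (r : List (Step S AH AL)) : Prop :=
  M.IsRunFrom M.init r

/-- The final state of a run. -/
def final (M : SyncMachine S AH AL O) (r : List (Step S AH AL)) : S :=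
  r.foldl (fun _ st => st.2) M.init

/-- The sequence of `H` actions of a run. -/
def actH (r : List (Step S AH AL)) : List AH := r.map (fun st => st.1.1)

/-- The `H` view of a run: the initial `H` observation followed by the
alternating sequence of `H` actions and `H` observations. -/
def viewH (M : SyncMachine S AH AL O) (r : List (Step S AH AL)) : O × List (AH × O) :=
  (M.obsH M.init, r.map (fun st => (st.1.1, M.obsH st.2)))

/-- The `L` view of a run. -/
def viewL (M : SyncMachine S AH AL O) (r : List (Step S AH AL)) : O × List (AL × O) :=
  (M.obsL M.init, r.map (fun st => (st.1.2, M.obsL st.2)))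

/-- An `H` strategy: a map from (candidate) `H` views to `H` actions. -/
abbrev Strategy (AH O : Type) := O × List (AH × O) → AH

def ConsistentFrom (M : SyncMachine S AH AL O) (π : Strategy AH O) :
    O × List (AH × O) → List (Step S AH AL) → Prop
  | _, [] => True
  | v, (a, t) :: rest =>
      a.1 = π v ∧ M.ConsistentFrom π (v.1, v.2 ++ [(a.1, M.obsH t)]) rest

/-- A run is consistent with an `H` strategy `π` if each of its `H` actions is
the one prescribed by `π` on the `H` view of the preceding prefix of the run. -/
def Consistent (M : SyncMachine S AH AL O) (π : Strategy AH O)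
    (r : List (Step S AH AL)) : Prop :=
  M.ConsistentFrom π (M.obsH M.init, []) r

/-- `Run(M, π)`: the runs of `M` consistent with `π`. -/
def stratRuns (M : SyncMachine S AH AL O) (π : Strategy AH O) :
    Set (List (Step S AH AL)) :=
  { r | M.IsRun r ∧ M.Consistent π r }

/-- The set of `L` views of a set of runs. -/
def lviews (M : SyncMachine S AH AL O) (R : Set (List (Step S AH AL))) :
    Set (O × List (AL × O)) :=
  M.viewL '' R

/-- Nondeducibility on strategies. -/
def NDS (M : SyncMachine S AH AL O) : Prop :=
  ∀ π₁ π₂ : Strategy AH O, M.lviews (M.stratRuns π₁) = M.lviews (M.stratRuns π₂)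

/-- Nondeducibility on inputs. -/
def NDI (M : SyncMachine S AH AL O) : Prop :=
  ∀ r : List (Step S AH AL), M.IsRun r →
    ∀ α : List AH, α.length = r.length →
      ∃ r', M.IsRun r' ∧ actH r' = α ∧ M.viewL r' = M.viewL r

/-- A synchronous unwinding relation on `M`. -/
def Unwinding (M : SyncMachine S AH AL O) (R : S → S → Prop) : Prop :=
  Symmetric R ∧ R M.init M.init ∧
  (∀ s t, R s t → M.obsL s = M.obsL t) ∧
  (∀ s t, R s t → ∀ (a₁ a₂ : AH) (a₃ : AL) (s' : S), M.trans s (a₁, a₃) s' →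
    ∃ t', M.trans t (a₂, a₃) t' ∧ R s' t')

/-- Restrictiveness: there exists a synchronous unwinding relation. -/
def RES (M : SyncMachine S AH AL O) : Prop :=
  ∃ R, M.Unwinding R

end SyncMachine


namespace SyncMachine

variable {S AH AL O : Type}

/-- Any run segment can be matched, step by step along an unwinding relation, by a segment that
follows a prescribed `H` strategy and shows `L` the same actions and observations. -/
theorem Unwinding.exists_consistentFrom {M : SyncMachine S AH AL O} {R : S → S → Prop}
    (hR : M.Unwinding R) (π : Strategy AH O) (r : List (Step S AH AL)) :
    ∀ {s t : S}, R s t → M.IsRunFrom s r → ∀ v : O × List (AH × O),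
      ∃ r', M.IsRunFrom t r' ∧ M.ConsistentFrom π v r' ∧
        r'.map (fun st => (st.1.2, M.obsL st.2)) = r.map (fun st => (st.1.2, M.obsL st.2)) := by
  induction r with
  | nil => exact fun _ _ _ => ⟨[], trivial, trivial, rfl⟩
  | cons st rest ih =>
    obtain ⟨⟨a, b⟩, s'⟩ := st
    intro s t hst hr v
    obtain ⟨t', htrans, hst'⟩ := hR.2.2.2 s t hst a (π v) b s' hr.1
    obtain ⟨r', hrun, hcons, hview⟩ := ih hst' hr.2 (v.1, v.2 ++ [(π v, M.obsH t')])
    refine ⟨((π v, b), t') :: r', ⟨htrans, hrun⟩, ⟨rfl, hcons⟩, ?_⟩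
    simp only [List.map_cons, hview, hR.2.2.1 s' t' hst']

theorem Unwinding.lviews_stratRuns_subset {M : SyncMachine S AH AL O} {R : S → S → Prop}
    (hR : M.Unwinding R) (π₁ π₂ : Strategy AH O) :
    M.lviews (M.stratRuns π₁) ⊆ M.lviews (M.stratRuns π₂) := by
  rintro _ ⟨r, ⟨hr, -⟩, rfl⟩
  obtain ⟨r', hrun, hcons, hview⟩ :=
    hR.exists_consistentFrom π₂ r hR.2.1 hr (M.obsH M.init, [])
  exact ⟨r', ⟨hrun, hcons⟩, congrArg (Prod.mk (M.obsL M.init)) hview⟩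

end SyncMachine

open SyncMachine in
/-- `RES ⊆ NDS`: if there exists a synchronous unwinding relation on `M`,
then `M` satisfies nondeducibility on strategies. -/
theorem res_subset_nds {S AH AL O : Type}
    (M : SyncMachine S AH AL O) (hM : M.InputEnabled) :
    M.RES → M.NDS := by
  rintro ⟨R, hR⟩ π₁ π₂
  exact (hR.lviews_stratRuns_subset π₁ π₂).antisymm (hR.lviews_stratRuns_subset π₂ π₁)
end

section
/- Let M be a synchronous machine. If M satisfies Nondeducibility on Strategies (NDS), then M satisfies Nondeducibility on Inputs (NDI). -/
namespace SyncMachine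

/-- The `H` strategy that plays the sequence `α` regardless of the observations made, and `d` once
`α` is exhausted. -/
def openLoop {AH O : Type} (α : List AH) (d : AH) : Strategy AH O :=
  fun v => α.getD v.2.length d

theorem consistentFrom_openLoop_iff {S AH AL O : Type} (M : SyncMachine S AH AL O)
    (α : List AH) (d : AH) (r : List (Step S AH AL)) (v : O × List (AH × O))
    (h : v.2.length + r.length = α.length) :
    M.ConsistentFrom (openLoop α d) v r ↔ actH r = α.drop v.2.length := by
  induction r generalizing v with
  | nil => simp_all [ConsistentFrom, actH]
  | cons st rest ih =>
    obtain ⟨a, t⟩ := st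
    have hlt : v.2.length < α.length := by
      simp only [List.length_cons] at h
      omega
    have hlen : (v.2 ++ [(a.1, M.obsH t)]).length + rest.length = α.length := by
      simp only [List.length_append, List.length_cons, List.length_nil] at h ⊢
      omega
    rw [ConsistentFrom, ih _ hlen, List.drop_eq_getElem_cons hlt]
    simp [actH, openLoop, hlt, -List.getElem_cons_drop]

theorem consistent_openLoop_iff {S AH AL O : Type} (M : SyncMachine S AH AL O)
    (α : List AH) (d : AH) (r : List (Step S AH AL)) (h : r.length = α.length) :
    M.Consistent (openLoop α d) r ↔ actH r = α := by
  simpa [Consistent] using M.consistentFrom_openLoop_iff α d r (M.obsH M.init, []) (by simpa using h)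

end SyncMachine

open SyncMachine in
/-- `NDS ⊆ NDI`: nondeducibility on strategies implies nondeducibility on
inputs. -/
theorem nds_subset_ndi {S AH AL O : Type}
    (M : SyncMachine S AH AL O) (hM : M.InputEnabled) :
    M.NDS → M.NDI := by
  intro hNDS r hr α hα
  cases α with
  | nil =>
    obtain rfl := List.eq_nil_of_length_eq_zero hα.symm
    exact ⟨[], hr, rfl, rfl⟩
  | cons d α =>
    have hview : M.viewL r ∈ M.lviews (M.stratRuns (openLoop (actH r) d)) :=
      ⟨r, ⟨hr, (M.consistent_openLoop_iff _ d r (by simp [actH])).2 rfl⟩, rfl⟩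
    rw [hNDS _ (openLoop (d :: α) d)] at hview
    obtain ⟨r', ⟨hr', hcons⟩, hv⟩ := hview
    have hlen : r'.length = r.length := by
      simpa [viewL] using congrArg (fun v => v.2.length) hv
    exact ⟨r', hr', (M.consistent_openLoop_iff _ d r' (hlen.trans hα.symm)).1 hcons, hv⟩
end

section
/- There exists a finite synchronous machine that satisfies Nondeducibility on Inputs (NDI) but does not satisfy Nondeducibility on Strategies (NDS); hence the containment NDS ⊆ NDI is strict. -/
namespace SyncMachine

/-- `H` observes a fresh random bit at every step; from the second step on, `L` observes the
exclusive or of the previous bit with the current action of `H`. A state other than the initial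
one holds the current bit together with the current observation of `L`. -/
def oneTimePad : SyncMachine (Option (Bool × Bool)) Bool Unit Bool where
  init := none
  trans s a t := ∃ b o, t = some (b, o) ∧ ∀ p, s = some p → o = xor p.1 a.1
  obsH s := s.elim false Prod.fst
  obsL s := s.elim false Prod.snd

theorem oneTimePad_inputEnabled : oneTimePad.InputEnabled := by
  rintro (_ | p) a
  · exact ⟨some (false, false), false, false, rfl, by simp⟩
  · exact ⟨some (false, xor p.1 a.1), false, _, rfl, by simp⟩

/-- The current bit can be chosen so that given actions of `H` produce a given continuation of
the `L` view. -/
theorem oneTimePad_exists_bit (r : List (Step (Option (Bool × Bool)) Bool Unit))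
    (α : List Bool) (hα : α.length = r.length) :
    ∃ b, ∀ s, (∀ p, s = some p → p.1 = b) →
      ∃ r', oneTimePad.IsRunFrom s r' ∧ actH r' = α ∧
        r'.map (fun st => (st.1.2, oneTimePad.obsL st.2)) =
          r.map (fun st => (st.1.2, oneTimePad.obsL st.2)) := by
  induction r generalizing α with
  | nil =>
    obtain rfl := List.length_eq_zero_iff.mp hα
    exact ⟨false, fun s _ => ⟨[], trivial, rfl, rfl⟩⟩
  | cons st r ih =>
    obtain _ | ⟨h, α⟩ := α
    · simp at hα
    obtain ⟨b, hb⟩ := ih α (by simpa using hα)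
    obtain ⟨r', hr', hact, hview⟩ := hb (some (b, oneTimePad.obsL st.2)) (by simp)
    refine ⟨xor (oneTimePad.obsL st.2) h, fun s hs =>
      ⟨((h, ()), some (b, oneTimePad.obsL st.2)) :: r', ⟨⟨b, _, rfl, ?_⟩, hr'⟩, ?_, ?_⟩⟩
    · intro p hp
      simp [hs p hp]
    · simpa [actH] using hact
    · rw [List.map_cons, List.map_cons, hview]
      rfl

theorem oneTimePad_ndi : oneTimePad.NDI := by
  intro r _ α hα
  obtain ⟨b, hb⟩ := oneTimePad_exists_bit r α hα
  obtain ⟨r', hr', hact, hview⟩ := hb none (by simp)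
  exact ⟨r', hr', hact, Prod.ext rfl hview⟩

/-- The strategy whose second action is the image under `f` of the bit just observed. -/
def secondActionStrategy (f : Bool → Bool) : Strategy Bool Bool
  | (_, [(_, b)]) => f b
  | _ => false

theorem oneTimePad_not_nds : ¬ oneTimePad.NDS := by
  intro hnds
  have hmem : (false, [((), false), ((), true)]) ∈
      oneTimePad.lviews (oneTimePad.stratRuns (secondActionStrategy not)) :=
    ⟨[((false, ()), some (false, false)), ((true, ()), some (false, true))],
      ⟨⟨⟨_, _, rfl, by simp [oneTimePad]⟩, ⟨_, _, rfl, by simp⟩, trivial⟩,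
        rfl, rfl, trivial⟩, rfl⟩
  rw [hnds _ (secondActionStrategy id)] at hmem
  obtain ⟨r, ⟨hrun, hcons⟩, hview⟩ := hmem
  match r, hrun, hcons, hview with
  | [], _, _, hview => simp [viewL] at hview
  | [_], _, _, hview => simp [viewL] at hview
  | _ :: _ :: _ :: _, _, _, hview => simp [viewL] at hview
  | [(a, s), (a', t)], hrun, hcons, hview =>
    obtain ⟨⟨b, o, rfl, -⟩, ⟨b', o', rfl, ho'⟩, -⟩ := hrun
    obtain ⟨-, ha', -⟩ := hcons
    have ha : a'.1 = b := ha'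
    simp [viewL, oneTimePad, ho' _ rfl, ha] at hview

end SyncMachine

open SyncMachine in
/-- There exists a finite synchronous machine satisfying `NDI` but not `NDS`:
the containment `NDS ⊆ NDI` is strict. -/
theorem ndi_not_nds_exists :
    ∃ (S AH AL O : Type) (M : SyncMachine S AH AL O),
      Finite S ∧ Finite AH ∧ Finite AL ∧ Finite O ∧
      M.InputEnabled ∧ M.NDI ∧ ¬ M.NDS :=
  ⟨_, _, _, _, oneTimePad, inferInstance, inferInstance, inferInstance, inferInstance,
    oneTimePad_inputEnabled, oneTimePad_ndi, oneTimePad_not_nds⟩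
end

section
/- There exists a finite synchronous machine that satisfies Nondeducibility on Strategies (NDS) but does not satisfy RES (i.e., no synchronous unwinding relation on it exists); hence the containment RES ⊆ NDS is strict. -/
namespace SyncMachine

variable {S AH AL O : Type}

/-- If `R` is an `L`-observation preserving simulation that is insensitive to the actions of `H`,
then any run from `s` can be matched, from any `t` related to `s`, by a run following a given
strategy. -/
theorem exists_consistent_run_of_simulation (M : SyncMachine S AH AL O) {R : S → S → Prop}
    (hobs : ∀ s t, R s t → M.obsL s = M.obsL t)
    (hstep : ∀ s t, R s t → ∀ (a₁ a₂ : AH) (a₃ : AL) (s' : S), M.trans s (a₁, a₃) s' →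
      ∃ t', M.trans t (a₂, a₃) t' ∧ R s' t')
    (π : Strategy AH O) (r : List (Step S AH AL)) {s t : S} (hst : R s t)
    (hr : M.IsRunFrom s r) (v : O × List (AH × O)) :
    ∃ r', M.IsRunFrom t r' ∧ M.ConsistentFrom π v r' ∧
      r'.map (fun st => (st.1.2, M.obsL st.2)) = r.map (fun st => (st.1.2, M.obsL st.2)) := by
  induction r generalizing s t v with
  | nil => exact ⟨[], trivial, trivial, rfl⟩
  | cons x r ih =>
    obtain ⟨⟨a, l⟩, s'⟩ := x
    obtain ⟨t', ht', hst'⟩ := hstep s t hst a (π v) l s' hr.1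
    obtain ⟨r', h₁, h₂, h₃⟩ := ih hst' hr.2 (v.1, v.2 ++ [(π v, M.obsH t')])
    exact ⟨((π v, l), t') :: r', ⟨ht', h₁⟩, ⟨rfl, h₂⟩, by simp [h₃, hobs s' t' hst']⟩

/-- `NDS` holds if every run has the same `L` view as some run consistent with any given
strategy. -/
theorem nds_of_forall_run (M : SyncMachine S AH AL O)
    (h : ∀ (π : Strategy AH O) (r : List (Step S AH AL)), M.IsRun r →
      ∃ r' ∈ M.stratRuns π, M.viewL r' = M.viewL r) : M.NDS := by
  have key : ∀ π₁ π₂, M.lviews (M.stratRuns π₁) ⊆ M.lviews (M.stratRuns π₂) := by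
    rintro π₁ π₂ _ ⟨r, hr, rfl⟩
    exact h π₂ r hr.1
  exact fun π₁ π₂ => (key π₁ π₂).antisymm (key π₂ π₁)

/-- States of `earlyLate`: `low` and `high` are absorbing, `willHigh` moves to `high`, and
`undecided` moves to either `low` or `high`. -/
inductive EarlyLateState
  | start | willHigh | undecided | low | high
  deriving DecidableEq

open EarlyLateState

instance : Finite EarlyLateState :=
  Fintype.finite ⟨{start, willHigh, undecided, low, high}, by rintro (_ | _) <;> simp⟩

/-- The action of `H` in the first step determines whether the machine decides between `low` and
`high` immediately or one step later. -/
def earlyLate : SyncMachine EarlyLateState Bool Unit Bool where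
  init := start
  trans s a t :=
    match s with
    | start => if a.1 then t = willHigh ∨ t = low else t = undecided
    | willHigh => t = high
    | undecided => t = low ∨ t = high
    | low => t = low
    | high => t = high
  obsH _ := false
  obsL
    | high => true
    | _ => false

theorem earlyLate_inputEnabled : earlyLate.InputEnabled := by
  rintro (_ | _ | _ | _ | _) ⟨_ | _, _⟩ <;> simp [earlyLate]

theorem earlyLate_isRunFrom_undecided {r : List (Step EarlyLateState Bool Unit)}
    (hr : earlyLate.IsRunFrom undecided r) :
    earlyLate.IsRunFrom willHigh r ∨ earlyLate.IsRunFrom low r := by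
  match r, hr with
  | [], _ => exact Or.inl trivial
  | (_, _) :: _, ⟨Or.inl h, hr⟩ => exact Or.inr ⟨h, hr⟩
  | (_, _) :: _, ⟨Or.inr h, hr⟩ => exact Or.inl ⟨h, hr⟩

/-- After the first step, a state is simulated by itself, and the two early decisions are
simulated by `undecided`. -/
def EarlyLateSim (s t : EarlyLateState) : Prop :=
  s ≠ start ∧ s = t ∨ (s = willHigh ∨ s = low) ∧ t = undecided

theorem EarlyLateSim.obsL_eq (s t : EarlyLateState) (h : EarlyLateSim s t) :
    earlyLate.obsL s = earlyLate.obsL t := by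
  rcases h with ⟨-, rfl⟩ | ⟨rfl | rfl, rfl⟩ <;> rfl

theorem EarlyLateSim.step (s t : EarlyLateState) (h : EarlyLateSim s t) (a₁ a₂ : Bool)
    (a₃ : Unit) (s' : EarlyLateState) (hs : earlyLate.trans s (a₁, a₃) s') :
    ∃ t', earlyLate.trans t (a₂, a₃) t' ∧ EarlyLateSim s' t' := by
  refine ⟨s', ?_⟩
  cases s <;> cases t <;> cases s' <;> simp_all [EarlyLateSim, earlyLate]

theorem earlyLate_nds : earlyLate.NDS := by
  refine nds_of_forall_run _ fun π r hr => ?_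
  match r, hr with
  | [], _ => exact ⟨[], ⟨trivial, trivial⟩, rfl⟩
  | ((a, l), t) :: r, ⟨ht, hr⟩ =>
    have hobs : earlyLate.obsL t = false := by
      cases a <;> cases t <;> simp_all [earlyLate]
    obtain ⟨s, u, hs, hsu, hu, huobs⟩ : ∃ s u, earlyLate.IsRunFrom s r ∧ EarlyLateSim s u ∧
        earlyLate.trans start (π (false, []), l) u ∧ earlyLate.obsL u = false := by
      have hcases : t = undecided ∨ t = willHigh ∨ t = low := by
        cases a <;> cases t <;> simp_all [earlyLate]
      cases π (false, []) with
      | false =>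
        refine ⟨t, undecided, hr, ?_, rfl, rfl⟩
        rcases hcases with rfl | rfl | rfl <;> simp [EarlyLateSim]
      | true =>
        have hearly : earlyLate.IsRunFrom willHigh r ∨ earlyLate.IsRunFrom low r := by
          rcases hcases with rfl | rfl | rfl
          exacts [earlyLate_isRunFrom_undecided hr, Or.inl hr, Or.inr hr]
        rcases hearly with h | h
        · exact ⟨willHigh, willHigh, h, by simp [EarlyLateSim], Or.inl rfl, rfl⟩
        · exact ⟨low, low, h, by simp [EarlyLateSim], Or.inr rfl, rfl⟩
    obtain ⟨r', h₁, h₂, h₃⟩ := exists_consistent_run_of_simulation _ EarlyLateSim.obsL_eq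
      EarlyLateSim.step π r hsu hs (false, [] ++ [(π (false, []), earlyLate.obsH u)])
    exact ⟨((π (false, []), l), u) :: r', ⟨⟨hu, h₁⟩, rfl, h₂⟩, by
      simp [viewL, h₃, hobs, huobs]⟩

theorem earlyLate_not_res : ¬ earlyLate.RES := by
  rintro ⟨R, hsymm, hinit, hobs, hstep⟩
  obtain ⟨t, ht, hR⟩ := hstep _ _ hinit true false () willHigh (Or.inl rfl)
  obtain rfl : t = undecided := ht
  obtain ⟨u, hu, hR'⟩ := hstep _ _ (hsymm hR) true true () low (Or.inl rfl)
  obtain rfl : u = high := hu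
  exact Bool.false_ne_true (hobs _ _ hR')

end SyncMachine

open SyncMachine in
/-- There exists a finite synchronous machine satisfying `NDS` but not `RES`:
the containment `RES ⊆ NDS` is strict. -/
theorem nds_not_res_exists :
    ∃ (S AH AL O : Type) (M : SyncMachine S AH AL O),
      Finite S ∧ Finite AH ∧ Finite AL ∧ Finite O ∧
      M.InputEnabled ∧ M.NDS ∧ ¬ M.RES :=
  ⟨EarlyLateState, Bool, Unit, Bool, earlyLate, inferInstance, inferInstance, inferInstance,
    inferInstance, earlyLate_inputEnabled, earlyLate_nds, earlyLate_not_res⟩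
end

section
/- Let M be a synchronous machine and LTS(M) its derived labelled transition system. If q₀ ⇒^{(a₁,b₁,a'₁)} (s₁,T₁) ⇒ … ⇒^{(aₙ,bₙ,a'ₙ)} (sₙ,Tₙ) is a path of LTS(M), then v = obs_L(s₀) b₁ obs_L(s₁) … bₙ obs_L(sₙ) is a possible L view of M, α = a'₁…a'ₙ is a sequence of H actions with |v| = |α|, and K(α, v) = Tₙ. Conversely, for every possible L view v of M of length n, say v = obs_L(s₀) b₁ obs_L(s₁) … bₙ obs_L(sₙ) for some run with states s₀,…,sₙ, and for every sequence of H actions α = a'₁…a'ₙ, there exists a path q₀ ⇒^{(a₁,b₁,a'₁)} (s₁,T₁) ⇒ … ⇒^{(aₙ,bₙ,a'ₙ)} (sₙ,Tₙ) of LTS(M) such that K(α, v) = Tₙ. -/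
namespace SyncMachine

variable {S AH AL O : Type}

/-- `K(α, v)`: the set of final states of runs `r` of `M` with
`Act_H(r) = α` and `view_L(r) = v`. -/
def Kset (M : SyncMachine S AH AL O) (α : List AH) (v : O × List (AL × O)) :
    Set S :=
  { s | ∃ r, M.IsRun r ∧ actH r = α ∧ M.viewL r = v ∧ M.final r = s }

/-- `δ_{a,b,o}(T) = { t | ∃ t' ∈ T, t' →^{(a,b)} t ∧ obs_L(t) = o }`. -/
def deltaL (M : SyncMachine S AH AL O) (a : AH) (b : AL) (o : O) (T : Set S) :
    Set S :=
  { t | ∃ t' ∈ T, M.trans t' (a, b) t ∧ M.obsL t = o }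

end SyncMachine

namespace SyncMachine

variable {S AH AL O : Type}

/-- The transition relation of `LTS(M)`: `(s,T) ⇒^{(a,b,a')} (s',T')` iff
`s →^{(a,b)} s'` and `T' = δ_{a',b,obs_L(s')}(T)`. -/
def ltsTrans (M : SyncMachine S AH AL O) :
    S × Set S → AH × AL × AH → S × Set S → Prop :=
  fun q l q' =>
    M.trans q.1 (l.1, l.2.1) q'.1 ∧ q'.2 = M.deltaL l.2.2 l.2.1 (M.obsL q'.1) q.2

def IsLTSPathFrom (M : SyncMachine S AH AL O) :
    S × Set S → List ((AH × AL × AH) × (S × Set S)) → Prop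
  | _, [] => True
  | q, (l, q') :: rest => M.ltsTrans q l q' ∧ M.IsLTSPathFrom q' rest

/-- A path of `LTS(M)` from the initial state `q₀ = (s₀, {s₀})`, represented
by its list of (label, state) steps. -/
def IsLTSPath (M : SyncMachine S AH AL O)
    (p : List ((AH × AL × AH) × (S × Set S))) : Prop :=
  M.IsLTSPathFrom (M.init, {M.init}) p

/-- The final state of a path of `LTS(M)`. -/
def ltsFinal (M : SyncMachine S AH AL O)
    (p : List ((AH × AL × AH) × (S × Set S))) : S × Set S :=
  p.foldl (fun _ st => st.2) (M.init, {M.init})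

end SyncMachine

namespace SyncMachine

variable {S AH AL O : Type}

/-- The second component of the final state of a path of `LTS(M)` collects the final states of
the runs, starting in the second component of its first state, that agree with the path. -/
theorem IsLTSPathFrom.mem_foldl_snd_iff {M : SyncMachine S AH AL O}
    {q : S × Set S} {p : List ((AH × AL × AH) × (S × Set S))}
    (hp : M.IsLTSPathFrom q p) (t : S) :
    t ∈ (p.foldl (fun _ st => st.2) q).2 ↔
      ∃ s ∈ q.2, ∃ r : List (Step S AH AL), M.IsRunFrom s r ∧
        actH r = p.map (fun st => st.1.2.2) ∧
        r.map (fun st => (st.1.2, M.obsL st.2))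
          = p.map (fun st => (st.1.2.1, M.obsL st.2.1)) ∧
        r.foldl (fun _ st => st.2) s = t := by
  induction p generalizing q with
  | nil =>
    constructor
    · intro ht
      exact ⟨t, ht, [], trivial, rfl, rfl, rfl⟩
    · rintro ⟨s, hs, r, -, hα, -, rfl⟩
      obtain rfl : r = [] := List.map_eq_nil_iff.mp hα
      exact hs
  | cons e p ih =>
    obtain ⟨⟨a, b, a'⟩, q'⟩ := e
    obtain ⟨⟨-, hq⟩, hp⟩ := hp
    rw [List.foldl_cons, ih hp, hq]
    constructor
    · rintro ⟨s, ⟨s₀, hs₀, htr, hobs⟩, r, hr, hα, hv, hf⟩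
      refine ⟨s₀, hs₀, ((a', b), s) :: r, ⟨htr, hr⟩, ?_, ?_, hf⟩
      · simpa [actH] using hα
      · simpa [hobs] using hv
    · rintro ⟨s₀, hs₀, r, hr, hα, hv, hf⟩
      cases r with
      | nil => simp at hv
      | cons x r =>
        obtain ⟨⟨c, d⟩, s⟩ := x
        obtain ⟨htr, hr⟩ := hr
        simp only [actH, List.map_cons, List.cons.injEq, Prod.mk.injEq] at hα hv
        obtain ⟨rfl, hα⟩ := hα
        obtain ⟨⟨rfl, hobs⟩, hv⟩ := hv
        exact ⟨s, ⟨s₀, hs₀, htr, hobs⟩, r, hr, hα, hv, hf⟩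

theorem IsLTSPath.Kset_eq {M : SyncMachine S AH AL O}
    {p : List ((AH × AL × AH) × (S × Set S))} (hp : M.IsLTSPath p) :
    M.Kset (p.map (fun st => st.1.2.2))
        (M.obsL M.init, p.map (fun st => (st.1.2.1, M.obsL st.2.1)))
      = (M.ltsFinal p).2 := by
  ext t
  rw [ltsFinal, IsLTSPathFrom.mem_foldl_snd_iff hp]
  simp [Kset, IsRun, viewL, final]

/-- Forgetting the second components along a path of `LTS(M)` gives a run. -/
theorem IsLTSPathFrom.isRunFrom {M : SyncMachine S AH AL O}
    {q : S × Set S} {p : List ((AH × AL × AH) × (S × Set S))}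
    (hp : M.IsLTSPathFrom q p) :
    M.IsRunFrom q.1 (p.map (fun st => ((st.1.1, st.1.2.1), st.2.1))) := by
  induction p generalizing q with
  | nil => trivial
  | cons e p ih => exact ⟨hp.1.1, ih hp.2⟩

/-- Every run lifts to a path of `LTS(M)` with prescribed third label components. -/
theorem IsRunFrom.exists_isLTSPathFrom {M : SyncMachine S AH AL O}
    {s : S} {r : List (Step S AH AL)} (hr : M.IsRunFrom s r) (T : Set S)
    {α : List AH} (hα : α.length = r.length) :
    ∃ p : List ((AH × AL × AH) × (S × Set S)), M.IsLTSPathFrom (s, T) p ∧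
      p.map (fun st => ((st.1.1, st.1.2.1), st.2.1)) = r ∧
      p.map (fun st => st.1.2.2) = α := by
  induction r generalizing s T α with
  | nil => exact ⟨[], trivial, rfl, (List.length_eq_zero_iff.mp hα).symm⟩
  | cons x r ih =>
    obtain ⟨⟨a, b⟩, t⟩ := x
    cases α with
    | nil => simp at hα
    | cons a' α =>
      obtain ⟨p, hp, rfl, rfl⟩ :=
        ih hr.2 (M.deltaL a' b (M.obsL t) T) (Nat.succ.inj hα)
      exact ⟨((a, b, a'), (t, M.deltaL a' b (M.obsL t) T)) :: p,
        ⟨⟨hr.1, rfl⟩, hp⟩, rfl, rfl⟩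

end SyncMachine

open SyncMachine in
/-- Lemma 1 (both directions). If `q₀ ⇒^{(a₁,b₁,a'₁)} (s₁,T₁) ⇒ … ⇒^{(aₙ,bₙ,a'ₙ)} (sₙ,Tₙ)`
is a path of `LTS(M)` then `v = obs_L(s₀) b₁ obs_L(s₁) … bₙ obs_L(sₙ)` is a
possible `L` view, `α = a'₁…a'ₙ` satisfies `|α| = |v|`, and `K(α,v) = Tₙ`.
Conversely, for every possible `L` view (arising from a run `r` with states
`s₀,…,sₙ` and `L` actions `b₁,…,bₙ`) and every `α = a'₁…a'ₙ`, there is a path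
of `LTS(M)` through the states `sᵢ`, with labels `(aᵢ,bᵢ,a'ᵢ)`, such that
`K(α, v) = Tₙ`. -/
theorem lts_characterizes_Kset {S AH AL O : Type}
    (M : SyncMachine S AH AL O) (hM : M.InputEnabled) :
    (∀ p : List ((AH × AL × AH) × (S × Set S)), M.IsLTSPath p →
      (∃ r, M.IsRun r ∧
          M.viewL r = (M.obsL M.init, p.map (fun st => (st.1.2.1, M.obsL st.2.1)))) ∧
      (p.map (fun st => st.1.2.2)).length
          = (p.map (fun st => (st.1.2.1, M.obsL st.2.1))).length ∧
      M.Kset (p.map (fun st => st.1.2.2))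
          (M.obsL M.init, p.map (fun st => (st.1.2.1, M.obsL st.2.1)))
        = (M.ltsFinal p).2)
    ∧
    (∀ r : List (Step S AH AL), M.IsRun r →
      ∀ α : List AH, α.length = r.length →
        ∃ p : List ((AH × AL × AH) × (S × Set S)), M.IsLTSPath p ∧
          p.map (fun st => st.2.1) = r.map Prod.snd ∧
          p.map (fun st => st.1.2.1) = r.map (fun st => st.1.2) ∧
          p.map (fun st => st.1.2.2) = α ∧
          M.Kset α (M.viewL r) = (M.ltsFinal p).2) := by
  constructor
  · intro p hp
    refine ⟨⟨_, IsLTSPathFrom.isRunFrom hp, ?_⟩, by simp, hp.Kset_eq⟩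
    simp [viewL]
  · intro r hr α hα
    obtain ⟨p, hp, rfl, rfl⟩ := IsRunFrom.exists_isLTSPathFrom hr {M.init} hα
    refine ⟨p, hp, by simp, by simp, rfl, ?_⟩
    rw [← IsLTSPath.Kset_eq hp]
    simp [viewL, Function.comp_def]
end

section
/- Let M be a finite synchronous machine with state set S. If M does not satisfy Nondeducibility on Inputs (NDI), then there exists a witness pair (α, v) — a possible L view v and a sequence α ∈ A_H* with |α| = |v| such that no run r of M has Act_H(r) = α and view_L(r) = v — with |α| ≤ |S| · 2^{|S|}. -/
/-- If every vertex witnessed at `n + 1` has a successor witnessed at `n`, then a least witness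
index in a finite type is smaller than the cardinality. -/
theorem exists_lt_card_of_step {V : Type*} [Finite V] (W : ℕ → V → Prop)
    (step : ∀ n v, W (n + 1) v → ∃ w, W n w ∧ ∀ k, W k w → W (k + 1) v)
    {n : ℕ} {v : V} (h : W n v) : ∃ m < Nat.card V, W m v := by
  have attained : ∀ n v, W n v → (∀ k < n, ¬ W k v) →
      ∀ m ≤ n, ∃ w, W m w ∧ ∀ k < m, ¬ W k w := by
    intro n
    induction n with
    | zero =>
      intro v hv hmin m hm
      obtain rfl : m = 0 := by omega
      exact ⟨v, hv, hmin⟩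
    | succ n ih =>
      intro v hv hmin m hm
      rcases hm.eq_or_lt with rfl | hlt
      · exact ⟨v, hv, hmin⟩
      · obtain ⟨w, hw, hback⟩ := step n v hv
        exact ih w hw (fun k hk hkw => hmin (k + 1) (by omega) (hback k hkw)) m (by omega)
  classical
  have hex : ∃ n, W n v := ⟨n, h⟩
  refine ⟨Nat.find hex, ?_, Nat.find_spec hex⟩
  choose f hf hfmin using
    attained (Nat.find hex) v (Nat.find_spec hex) (fun k hk => Nat.find_min hex hk)
  have hinj : Function.Injective
      (fun i : Fin (Nat.find hex + 1) => f i (Nat.lt_succ_iff.mp i.2)) := by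
    intro i j hij
    dsimp only at hij
    apply Fin.ext
    by_contra hne
    rcases Nat.lt_or_gt_of_ne hne with hlt | hlt
    · exact hfmin j _ i hlt (hij ▸ hf i _)
    · exact hfmin i _ j hlt (hij ▸ hf j _)
  have hcard := Nat.card_le_card_of_injective _ hinj
  rw [Nat.card_fin] at hcard
  omega

namespace SyncMachine

/-- The pair `(s, K)` admits a run of length `n` from `s` and a sequence of `n` actions of `H` for
which no run starting in `K` has the same sequence of `L` events. -/
def WitnessFrom {S AH AL O : Type} (M : SyncMachine S AH AL O) (n : ℕ) (p : S × Set S) : Prop :=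
  ∃ (r : List (Step S AH AL)) (α : List AH), r.length = n ∧ α.length = n ∧
    M.IsRunFrom p.1 r ∧
    ¬ ∃ t ∈ p.2, ∃ r', M.IsRunFrom t r' ∧ actH r' = α ∧
      r'.map (fun st => (st.1.2, M.obsL st.2)) = r.map (fun st => (st.1.2, M.obsL st.2))

theorem WitnessFrom.exists_step {S AH AL O : Type} (M : SyncMachine S AH AL O) (n : ℕ)
    (p : S × Set S) (h : M.WitnessFrom (n + 1) p) :
    ∃ q, M.WitnessFrom n q ∧ ∀ k, M.WitnessFrom k q → M.WitnessFrom (k + 1) p := by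
  obtain ⟨r, α, hr, hα, hrun, hno⟩ := h
  obtain ⟨⟨a, t⟩, r, rfl⟩ := List.exists_cons_of_length_eq_add_one hr
  obtain ⟨b, α, rfl⟩ := List.exists_cons_of_length_eq_add_one hα
  refine ⟨(t, {t' | ∃ u ∈ p.2, M.trans u (b, a.2) t' ∧ M.obsL t' = M.obsL t}),
    ⟨r, α, by simpa using hr, by simpa using hα, hrun.2, ?_⟩, ?_⟩
  · rintro ⟨t', ⟨u, hu, htrans, hobs⟩, r', hr', rfl, hview⟩
    exact hno ⟨u, hu, ((b, a.2), t') :: r', ⟨htrans, hr'⟩, by simp [actH], by simp [hobs, hview]⟩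
  · rintro k ⟨r₁, α₁, hr₁, hα₁, hrun₁, hno₁⟩
    refine ⟨(a, t) :: r₁, b :: α₁, by simp [hr₁], by simp [hα₁], ⟨hrun.1, hrun₁⟩, ?_⟩
    rintro ⟨u, hu, r', hr', hact, hview⟩
    obtain _ | ⟨⟨⟨c, d⟩, t'⟩, r'⟩ := r'
    · simp at hview
    · simp only [actH, List.map_cons, List.cons.injEq, Prod.mk.injEq] at hact hview
      obtain ⟨rfl, hact⟩ := hact
      obtain ⟨⟨rfl, hobs⟩, hview⟩ := hview
      exact hno₁ ⟨t', ⟨u, hu, hr'.1, hobs⟩, r', hr'.2, hact, hview⟩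

end SyncMachine

open SyncMachine in
/-- If a finite machine `M` is not in `NDI`, then there is a witness pair
`(α, v)` with `|α| ≤ |S| · 2^{|S|}`. -/
theorem ndi_short_witness {S AH AL O : Type}
    [Finite S] [Finite AH] [Finite AL] [Finite O]
    (M : SyncMachine S AH AL O) (hM : M.InputEnabled) :
    ¬ M.NDI →
      ∃ (v : O × List (AL × O)) (α : List AH),
        (∃ r, M.IsRun r ∧ M.viewL r = v) ∧
        α.length = v.2.length ∧
        (¬ ∃ r, M.IsRun r ∧ actH r = α ∧ M.viewL r = v) ∧
        α.length ≤ Nat.card S * 2 ^ (Nat.card S) := by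
  intro hNDI
  simp only [NDI, not_forall] at hNDI
  obtain ⟨r, hr, α, hα, hno⟩ := hNDI
  have hW : M.WitnessFrom r.length (M.init, {M.init}) := by
    refine ⟨r, α, rfl, hα, hr, ?_⟩
    rintro ⟨_, rfl, r', hr', hact, hview⟩
    exact hno ⟨r', hr', hact, by simp [viewL, hview]⟩
  obtain ⟨m, hm, r, α, hrlen, hαlen, hrun, hnone⟩ :=
    exists_lt_card_of_step M.WitnessFrom (WitnessFrom.exists_step M) hW
  refine ⟨M.viewL r, α, ⟨r, hrun, rfl⟩, by simp [viewL, hrlen, hαlen], ?_, ?_⟩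
  · rintro ⟨r', hr', hact, hview⟩
    exact hnone ⟨M.init, rfl, r', hr', hact, (Prod.ext_iff.mp hview).2⟩
  · have hset : Nat.card (Set S) = 2 ^ Nat.card S := by
      have := Fintype.ofFinite S
      simp [Nat.card_eq_fintype_card]
    rw [Nat.card_prod, hset] at hm
    omega
end

section
/- Let M be a synchronous machine and π an H strategy defined on all candidate H views O(A_H O)*. Suppose π(α) = a_H and |α| = |β|, where α is a candidate H view and β a candidate L view. Then for all o_H, o_L ∈ O and a_L ∈ A_L, δ_{a_H,o_H,a_L,o_L}(K(α, π, β)) = K(α a_H o_H, π, β a_L o_L). -/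
namespace SyncMachine

variable {S AH AL O : Type}

/-- `δ_{a_H,o_H,a_L,o_L}(T)`. -/
def delta4 (M : SyncMachine S AH AL O) (aH : AH) (oH : O) (aL : AL) (oL : O)
    (T : Set S) : Set S :=
  { s | ∃ t ∈ T, M.trans t (aH, aL) s ∧ M.obsH s = oH ∧ M.obsL s = oL }

/-- `K(α, π, β)`: the set of final states of runs `r` consistent with `π`
such that `view_H(r) = α` and `view_L(r)` is a prefix of `β`. -/
def Kstrat (M : SyncMachine S AH AL O) (π : Strategy AH O)
    (α : O × List (AH × O)) (β : O × List (AL × O)) : Set S :=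
  { s | ∃ r, M.IsRun r ∧ M.Consistent π r ∧ M.viewH r = α ∧
        (M.viewL r).1 = β.1 ∧ (M.viewL r).2 <+: β.2 ∧ M.final r = s }

/-- The strategy `π` excludes the candidate `L` view `β` if no run consistent
with `π` has `L` view `β`. -/
def Excludes (M : SyncMachine S AH AL O) (π : Strategy AH O)
    (β : O × List (AL × O)) : Prop :=
  ¬ ∃ r, M.IsRun r ∧ M.Consistent π r ∧ M.viewL r = β

end SyncMachine

namespace SyncMachine

variable {S AH AL O : Type}

theorem isRunFrom_append_singleton (M : SyncMachine S AH AL O) (s : S)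
    (r : List (Step S AH AL)) (a : AH × AL) (t : S) :
    M.IsRunFrom s (r ++ [(a, t)]) ↔
      M.IsRunFrom s r ∧ M.trans (r.foldl (fun _ st => st.2) s) a t := by
  induction r generalizing s with
  | nil => simp [IsRunFrom]
  | cons x r ih => simp [IsRunFrom, ih, and_assoc]

theorem isRun_append_singleton (M : SyncMachine S AH AL O)
    (r : List (Step S AH AL)) (a : AH × AL) (t : S) :
    M.IsRun (r ++ [(a, t)]) ↔ M.IsRun r ∧ M.trans (M.final r) a t :=
  M.isRunFrom_append_singleton M.init r a t

theorem consistentFrom_append_singleton (M : SyncMachine S AH AL O) (π : Strategy AH O)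
    (v : O × List (AH × O)) (r : List (Step S AH AL)) (a : AH × AL) (t : S) :
    M.ConsistentFrom π v (r ++ [(a, t)]) ↔
      M.ConsistentFrom π v r ∧ a.1 = π (v.1, v.2 ++ (M.viewH r).2) := by
  induction r generalizing v with
  | nil => simp [ConsistentFrom, viewH]
  | cons x r ih => simp [ConsistentFrom, ih, and_assoc, viewH]

theorem consistent_append_singleton (M : SyncMachine S AH AL O) (π : Strategy AH O)
    (r : List (Step S AH AL)) (a : AH × AL) (t : S) :
    M.Consistent π (r ++ [(a, t)]) ↔ M.Consistent π r ∧ a.1 = π (M.viewH r) :=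
  M.consistentFrom_append_singleton π (M.obsH M.init, []) r a t

theorem final_append_singleton (M : SyncMachine S AH AL O)
    (r : List (Step S AH AL)) (a : AH × AL) (t : S) :
    M.final (r ++ [(a, t)]) = t := by
  simp [final]

theorem viewH_append_singleton (M : SyncMachine S AH AL O)
    (r : List (Step S AH AL)) (a : AH × AL) (t : S) :
    M.viewH (r ++ [(a, t)]) = ((M.viewH r).1, (M.viewH r).2 ++ [(a.1, M.obsH t)]) := by
  simp [viewH]

theorem viewL_append_singleton (M : SyncMachine S AH AL O)
    (r : List (Step S AH AL)) (a : AH × AL) (t : S) :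
    M.viewL (r ++ [(a, t)]) = ((M.viewL r).1, (M.viewL r).2 ++ [(a.2, M.obsL t)]) := by
  simp [viewL]

/-- For views of equal length, the prefix condition in `Kstrat` is an equality. -/
theorem mem_Kstrat_of_length_eq (M : SyncMachine S AH AL O) (π : Strategy AH O)
    {α : O × List (AH × O)} {β : O × List (AL × O)} (hlen : α.2.length = β.2.length) (s : S) :
    s ∈ M.Kstrat π α β ↔
      ∃ r, M.IsRun r ∧ M.Consistent π r ∧ M.viewH r = α ∧ M.viewL r = β ∧ M.final r = s := by
  constructor
  · rintro ⟨r, hr, hc, rfl, h₁, h₂, hf⟩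
    exact ⟨r, hr, hc, rfl, Prod.ext h₁ (h₂.eq_of_length (by simpa [viewH, viewL] using hlen)), hf⟩
  · rintro ⟨r, hr, hc, hH, rfl, hf⟩
    exact ⟨r, hr, hc, hH, rfl, List.prefix_rfl, hf⟩

end SyncMachine

open SyncMachine in
/-- Lemma 2: if `π(α) = a_H` and `|α| = |β|` then
`δ_{a_H,o_H,a_L,o_L}(K(α,π,β)) = K(α a_H o_H, π, β a_L o_L)`. -/
theorem Kstrat_snoc {S AH AL O : Type}
    (M : SyncMachine S AH AL O) (hM : M.InputEnabled)
    (π : Strategy AH O) (α : O × List (AH × O)) (β : O × List (AL × O))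
    (aH : AH) (hπ : π α = aH) (hlen : α.2.length = β.2.length) :
    ∀ (oH oL : O) (aL : AL),
      M.delta4 aH oH aL oL (M.Kstrat π α β)
        = M.Kstrat π (α.1, α.2 ++ [(aH, oH)]) (β.1, β.2 ++ [(aL, oL)]) := by
  intro oH oL aL
  have hlen' : (α.2 ++ [(aH, oH)]).length = (β.2 ++ [(aL, oL)]).length := by simp [hlen]
  ext s
  rw [mem_Kstrat_of_length_eq (α := (α.1, α.2 ++ [(aH, oH)]))
    (β := (β.1, β.2 ++ [(aL, oL)])) M π hlen']
  constructor
  · rintro ⟨t, ht, hstep, rfl, rfl⟩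
    obtain ⟨r, hr, hc, rfl, rfl, rfl⟩ := (M.mem_Kstrat_of_length_eq π hlen t).1 ht
    exact ⟨r ++ [((aH, aL), s)], (M.isRun_append_singleton r _ s).2 ⟨hr, hstep⟩,
      (M.consistent_append_singleton π r _ s).2 ⟨hc, hπ.symm⟩,
      M.viewH_append_singleton r _ s, M.viewL_append_singleton r _ s,
      M.final_append_singleton r _ s⟩
  · rintro ⟨r, hr, hc, hH, hL, rfl⟩
    rcases List.eq_nil_or_concat r with rfl | ⟨r, ⟨⟨a, b⟩, t⟩, rfl⟩
    · simp [viewH] at hH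
    · rw [List.concat_eq_append] at hr hc hH hL ⊢
      rw [isRun_append_singleton] at hr
      rw [consistent_append_singleton] at hc
      simp only [viewH_append_singleton, Prod.mk.injEq, List.append_singleton_inj] at hH
      simp only [viewL_append_singleton, Prod.mk.injEq, List.append_singleton_inj] at hL
      obtain ⟨hH₁, hH₂, rfl, rfl⟩ := hH
      obtain ⟨hL₁, hL₂, rfl, rfl⟩ := hL
      rw [final_append_singleton]
      exact ⟨M.final r, (M.mem_Kstrat_of_length_eq π hlen _).2
        ⟨r, hr.1, hc.1, Prod.ext hH₁ hH₂, Prod.ext hL₁ hL₂, rfl⟩, hr.2, rfl, rfl⟩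
end

section
/- Let M be a synchronous machine. If ∼₁ and ∼₂ are synchronous unwinding relations on M, then their relational composition ∼₁ ∘ ∼₂ (relating s to t when there exists x with s ∼₁ x and x ∼₂ t) satisfies conditions (1), (2) and (3) of the definition of a synchronous unwinding relation on M. -/
open SyncMachine in
/-- The relational composition of two synchronous unwinding relations
satisfies conditions (1), (2) and (3) of the definition of a synchronous
unwinding relation. -/
theorem unwinding_comp {S AH AL O : Type}
    (M : SyncMachine S AH AL O) (hM : M.InputEnabled)
    (R₁ R₂ : S → S → Prop)
    (h₁ : M.Unwinding R₁) (h₂ : M.Unwinding R₂) :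
    (fun s t => ∃ x, R₁ s x ∧ R₂ x t) M.init M.init ∧
    (∀ s t, (∃ x, R₁ s x ∧ R₂ x t) → M.obsL s = M.obsL t) ∧
    (∀ s t, (∃ x, R₁ s x ∧ R₂ x t) →
      ∀ (a₁ a₂ : AH) (a₃ : AL) (s' : S), M.trans s (a₁, a₃) s' →
        ∃ t', M.trans t (a₂, a₃) t' ∧ ∃ x, R₁ s' x ∧ R₂ x t') := by
  obtain ⟨-, init₁, obs₁, step₁⟩ := h₁
  obtain ⟨-, init₂, obs₂, step₂⟩ := h₂
  refine ⟨⟨M.init, init₁, init₂⟩, ?_, ?_⟩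
  · rintro s t ⟨x, hsx, hxt⟩
    exact (obs₁ s x hsx).trans (obs₂ x t hxt)
  · rintro s t ⟨x, hsx, hxt⟩ a₁ a₂ a₃ s' hs
    obtain ⟨x', hx, hsx'⟩ := step₁ s x hsx a₁ a₂ a₃ s' hs
    obtain ⟨t', ht, hxt'⟩ := step₂ x t hxt a₂ a₂ a₃ x' hx
    exact ⟨t', ht, x', hsx', hxt'⟩
end

section
/- Let M be a synchronous machine. The transitive closure of any synchronous unwinding relation on M is a synchronous unwinding relation on M. -/
open SyncMachine in
/-- The transitive closure of a synchronous unwinding relation is a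
synchronous unwinding relation. -/
theorem unwinding_transGen {S AH AL O : Type}
    (M : SyncMachine S AH AL O) (hM : M.InputEnabled)
    (R : S → S → Prop) (h : M.Unwinding R) :
    M.Unwinding (Relation.TransGen R) := by
  obtain ⟨hsymm, hinit, hobs, hstep⟩ := h
  refine ⟨fun s t hst => ?_, .single hinit, fun s t hst => ?_, fun s t hst => ?_⟩
  · induction hst with
    | single h => exact .single (hsymm h)
    | tail _ h ih => exact .head (hsymm h) ih
  · induction hst with
    | single h => exact hobs _ _ h
    | tail _ h ih => exact ih.trans (hobs _ _ h)
  · induction hst with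
    | single h =>
      intro a₁ a₂ a₃ s' hs'
      obtain ⟨t', ht', hR⟩ := hstep _ _ h a₁ a₂ a₃ s' hs'
      exact ⟨t', ht', .single hR⟩
    | tail _ h ih =>
      intro a₁ a₂ a₃ s' hs'
      obtain ⟨u', hu', hsu⟩ := ih a₁ a₂ a₃ s' hs'
      obtain ⟨t', ht', hut⟩ := hstep _ _ h a₂ a₂ a₃ u' hu'
      exact ⟨t', ht', hsu.tail hut⟩
end

section
/- Let M be a synchronous machine. If there exists a synchronous unwinding relation on M, then there exists a largest synchronous unwinding relation on M (one containing every synchronous unwinding relation on M), and this largest relation is transitive. -/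
namespace SyncMachine

variable {S AH AL O : Type}

/-- The union of all synchronous unwinding relations on `M`. -/
def unwindingUnion (M : SyncMachine S AH AL O) (s t : S) : Prop :=
  ∃ R, M.Unwinding R ∧ R s t

theorem Unwinding.unwindingUnion {M : SyncMachine S AH AL O} {R : S → S → Prop}
    (hR : M.Unwinding R) : M.Unwinding M.unwindingUnion := by
  refine ⟨?_, ⟨R, hR, hR.2.1⟩, ?_, ?_⟩
  · rintro s t ⟨Q, hQ, hst⟩
    exact ⟨Q, hQ, hQ.1 hst⟩
  · rintro s t ⟨Q, hQ, hst⟩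
    exact hQ.2.2.1 s t hst
  · rintro s t ⟨Q, hQ, hst⟩ a₁ a₂ a₃ s' hs
    obtain ⟨t', ht, hst'⟩ := hQ.2.2.2 s t hst a₁ a₂ a₃ s' hs
    exact ⟨t', ht, Q, hQ, hst'⟩

/-- The transitive closure of a synchronous unwinding relation is one as well. -/
theorem Unwinding.transGen {M : SyncMachine S AH AL O} {R : S → S → Prop}
    (hR : M.Unwinding R) : M.Unwinding (Relation.TransGen R) := by
  obtain ⟨hsymm, hinit, hobs, hstep⟩ := hR
  refine ⟨?_, .single hinit, ?_, ?_⟩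
  · intro s t h
    induction h with
    | single h => exact .single (hsymm h)
    | tail _ h ih => exact .head (hsymm h) ih
  · intro s t h
    induction h with
    | single h => exact hobs _ _ h
    | tail _ h ih => exact ih.trans (hobs _ _ h)
  · intro s t h a₁ a₂ a₃ s' hs
    induction h with
    | single h =>
      obtain ⟨t', ht, h'⟩ := hstep _ _ h a₁ a₂ a₃ s' hs
      exact ⟨t', ht, .single h'⟩
    | tail _ h ih =>
      obtain ⟨t', ht, h'⟩ := ih
      obtain ⟨u', hu, h''⟩ := hstep _ _ h a₂ a₂ a₃ t' ht
      exact ⟨u', hu, h'.tail h''⟩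

end SyncMachine

open SyncMachine in
/-- If there exists a synchronous unwinding relation on `M`, then there exists
a largest one, and it is transitive. -/
theorem exists_largest_unwinding {S AH AL O : Type}
    (M : SyncMachine S AH AL O) (hM : M.InputEnabled) :
    (∃ R, M.Unwinding R) →
      ∃ Rmax : S → S → Prop, M.Unwinding Rmax ∧
        (∀ R : S → S → Prop, M.Unwinding R → ∀ s t, R s t → Rmax s t) ∧
        Transitive Rmax := by
  rintro ⟨R, hR⟩
  have hU := hR.unwindingUnion
  exact ⟨M.unwindingUnion, hU, fun Q hQ s t hst => ⟨Q, hQ, hst⟩,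
    fun _ _ _ hst htu => ⟨_, hU.transGen, .tail (.single hst) htu⟩⟩
end

section
/- Let M be a synchronous machine in which every state is reachable (every s ∈ S is the final state of some run). If there exists a synchronous unwinding relation on M, then the largest synchronous unwinding relation on M is an equivalence relation (in particular it is reflexive on S). -/
namespace SyncMachine

variable {S AH AL O : Type}

/-- A state is reachable if it is the final state of some run. -/
def Reach (M : SyncMachine S AH AL O) (s : S) : Prop :=
  ∃ r, M.IsRun r ∧ M.final r = s

end SyncMachine

namespace SyncMachine

variable {S AH AL O : Type} {M : SyncMachine S AH AL O}

/-- The composite of the largest unwinding relation with itself is an unwinding relation. -/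
theorem Unwinding.comp_sup (hres : ∃ R, M.Unwinding R) :
    M.Unwinding (Relation.Comp (fun s t => ∃ R, M.Unwinding R ∧ R s t)
      (fun s t => ∃ R, M.Unwinding R ∧ R s t)) := by
  obtain ⟨R, hR⟩ := hres
  refine ⟨?_, ⟨M.init, ⟨R, hR, hR.2.1⟩, ⟨R, hR, hR.2.1⟩⟩, ?_, ?_⟩
  · rintro s u ⟨t, ⟨R₁, h₁, hst⟩, ⟨R₂, h₂, htu⟩⟩
    exact ⟨t, ⟨R₂, h₂, h₂.1 htu⟩, ⟨R₁, h₁, h₁.1 hst⟩⟩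
  · rintro s u ⟨t, ⟨R₁, h₁, hst⟩, ⟨R₂, h₂, htu⟩⟩
    exact (h₁.2.2.1 s t hst).trans (h₂.2.2.1 t u htu)
  · rintro s u ⟨t, ⟨R₁, h₁, hst⟩, ⟨R₂, h₂, htu⟩⟩ a₁ a₂ a₃ s' hs
    obtain ⟨t', ht, hst'⟩ := h₁.2.2.2 s t hst a₁ a₂ a₃ s' hs
    obtain ⟨u', hu, htu'⟩ := h₂.2.2.2 t u htu a₂ a₂ a₃ t' ht
    exact ⟨u', hu, t', ⟨R₁, h₁, hst'⟩, ⟨R₂, h₂, htu'⟩⟩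

theorem Unwinding.exists_rel_of_isRunFrom {R : S → S → Prop} (hR : M.Unwinding R)
    (r : List (Step S AH AL)) (s : S) (hs : ∃ t, R s t) (hr : M.IsRunFrom s r) :
    ∃ t, R (r.foldl (fun _ st => st.2) s) t := by
  induction r generalizing s with
  | nil => exact hs
  | cons st r ih =>
    obtain ⟨⟨a₁, a₃⟩, s'⟩ := st
    obtain ⟨t, hst⟩ := hs
    obtain ⟨t', -, hst'⟩ := hR.2.2.2 s t hst a₁ a₁ a₃ s' hr.1
    exact ih s' ⟨t', hst'⟩ hr.2

/-- An unwinding relation relates every reachable state to some state. -/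
theorem Unwinding.exists_rel_of_reach {R : S → S → Prop} (hR : M.Unwinding R) {s : S}
    (hs : M.Reach s) : ∃ t, R s t := by
  obtain ⟨r, hr, rfl⟩ := hs
  exact hR.exists_rel_of_isRunFrom r M.init ⟨M.init, hR.2.1⟩ hr

end SyncMachine

open SyncMachine in
/-- If all states of `M` are reachable and some synchronous unwinding relation
exists, then the largest synchronous unwinding relation (the union of all of
them) is an equivalence relation. -/
theorem largest_unwinding_equivalence {S AH AL O : Type}
    (M : SyncMachine S AH AL O) (hM : M.InputEnabled)
    (hreach : ∀ s : S, M.Reach s) (hres : ∃ R, M.Unwinding R) :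
    Equivalence (fun s t : S => ∃ R, M.Unwinding R ∧ R s t) := by
  have hcomp := Unwinding.comp_sup hres
  refine ⟨fun s => ?_, ?_, fun hst htu => ⟨_, hcomp, _, hst, htu⟩⟩
  · obtain ⟨R, hR⟩ := hres
    obtain ⟨t, hst⟩ := hR.exists_rel_of_reach (hreach s)
    exact ⟨_, hcomp, t, ⟨R, hR, hst⟩, ⟨R, hR, hR.1 hst⟩⟩
  · rintro s t ⟨R, hR, hst⟩
    exact ⟨R, hR, hR.1 hst⟩
end
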